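/- arXiv:2404.10482 — 2 statements merged into one kernel-verified Lean document; each statement's English description precedes it below -/
import Mathlib

section
/- Let I ⊆ Q be ideals of K[X] and let J be a separating ideal for (I, Q), i.e., I = Q ∩ (I + J). If f ∈ √(I : Q), then there exists a positive integer m such that I = Q ∩ (I + J + ⟨f^m⟩). -/
open MvPolynomial Ideal

/-- The action of a permutation `σ ∈ S_n` on the polynomial ring `K[x_1,…,x_n]`
by renaming the variables: `σ(f(x_1,…,x_n)) = f(x_{σ(1)},…,x_{σ(n)})`,
applied to an ideal `I`, giving `σ(I) = {σ(f) : f ∈ I}`. -/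
noncomputable def permIdeal {K : Type*} [Field K] {n : ℕ} (σ : Equiv.Perm (Fin n))
    (I : Ideal (MvPolynomial (Fin n) K)) : Ideal (MvPolynomial (Fin n) K) :=
  I.map (rename (σ : Fin n → Fin n) : MvPolynomial (Fin n) K →ₐ[K] MvPolynomial (Fin n) K)

/-- In a Noetherian ring, the ideal quotients of an ideal by the powers of an element stabilize. -/
theorem exists_forall_mul_pow_mem_of_mul_pow_mem {R : Type*} [CommRing R] [IsNoetherianRing R]
    (I : Ideal R) (f : R) :
    ∃ m : ℕ, ∀ k : ℕ, ∀ c : R, c * f ^ (m + k) ∈ I → c * f ^ m ∈ I := by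
  let quotientChain : ℕ →o Ideal R :=
    { toFun := fun k => Submodule.comap (LinearMap.mulRight R (f ^ k)) I
      monotone' := by
        intro a b hab c hc
        obtain ⟨d, rfl⟩ := Nat.exists_eq_add_of_le hab
        simp only [Submodule.mem_comap, LinearMap.mulRight_apply] at hc ⊢
        rw [pow_add, ← mul_assoc]
        exact I.mul_mem_right _ hc }
  obtain ⟨m, hm⟩ := monotone_stabilizes_iff_noetherian.mpr ‹IsNoetherianRing R› quotientChain
  refine ⟨m, fun k c hc => ?_⟩
  have hmem : c ∈ quotientChain (m + k) := hc
  rw [← hm (m + k) (Nat.le_add_right m k)] at hmem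
  exact hmem

/-- If `I ⊆ Q` and `J` is a separating ideal for `(I, Q)`, i.e. `I = Q ∩ (I + J)`,
then for every `f ∈ √(I : Q)` there is a positive integer `m` with
`I = Q ∩ (I + J + ⟨f^m⟩)`. -/
theorem exists_pow_separating {K : Type*} [Field K] {n : ℕ}
    (I Q J : Ideal (MvPolynomial (Fin n) K)) (hIQ : I ≤ Q)
    (hsep : I = Q ⊓ (I + J))
    (f : MvPolynomial (Fin n) K) (hf : f ∈ (I.colon Q).radical) :
    ∃ m : ℕ, 0 < m ∧ I = Q ⊓ (I + J + Ideal.span {f ^ m}) := by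
  obtain ⟨k, hk⟩ := hf
  obtain ⟨m, hm⟩ := exists_forall_mul_pow_mem_of_mul_pow_mem (I + J) f
  refine ⟨m + 1, Nat.succ_pos m, le_antisymm (le_inf hIQ ?_) ?_⟩
  · exact le_sup_left.trans le_sup_left
  · rintro q ⟨hqQ, hq⟩
    obtain ⟨a, ha, b, hb, rfl⟩ := Submodule.mem_sup.mp hq
    obtain ⟨c, rfl⟩ := Ideal.mem_span_singleton'.mp hb
    have hI : f ^ k * (a + c * f ^ (m + 1)) ∈ I := by
      simpa using Submodule.mem_colon.mp hk _ hqQ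
    have hIJ : f ^ k * (a + c * f ^ (m + 1)) ∈ I + J := le_sup_left (a := I) (b := J) hI
    have hc : c * f ^ (m + (1 + k)) ∈ I + J := by
      convert (I + J).sub_mem hIJ ((I + J).mul_mem_left (f ^ k) ha) using 1
      ring
    have hcm : c * f ^ (m + 1) ∈ I + J := by
      rw [pow_succ, ← mul_assoc]
      exact (I + J).mul_mem_right f (hm _ c hc)
    rw [hsep]
    exact ⟨hqQ, (I + J).add_mem ha hcm⟩
end

section
/- Let G be a subgroup of S_n and let I and Q be G-invariant ideals of K[X] with I ⊆ Q. Let J be a G-invariant ideal which is a separating ideal for (I, Q), i.e., I = Q ∩ (I + J). Then there exist a non-negative integer l and polynomials f_1,...,f_l ∈ K[X] such that: (1) I = Q ∩ (I + J + ⟨f_1,...,f_l⟩); (2) ⟨f_1,...,f_l⟩ is a G-invariant ideal; and (3) J + ⟨f_1,...,f_l⟩ is a saturated separating ideal for (I, Q), i.e., √(I : Q) = √(I + J + ⟨f_1,...,f_l⟩). -/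
open MvPolynomial Ideal

/-- By Artin–Rees, adding a high power of `I.colon Q` to `J` keeps the intersection with `Q`
inside `J`, provided `I ≤ J`. -/
theorem Ideal.exists_inf_sup_colon_pow_le {R : Type*} [CommRing R] [IsNoetherianRing R]
    {I J : Ideal R} (Q : Ideal R) (hIJ : I ≤ J) :
    ∃ k : ℕ, Q ⊓ (J ⊔ I.colon Q ^ (k + 1)) ≤ J := by
  set C : Ideal R := I.colon (Q : Set R)
  obtain ⟨k, hk⟩ := C.exists_pow_inf_eq_pow_smul (Submodule.map J.mkQ Q)
  refine ⟨k, fun x hx => ?_⟩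
  obtain ⟨hxQ, hxJ⟩ := hx
  obtain ⟨a, ha, c, hc, rfl⟩ := Submodule.mem_sup.1 hxJ
  have hmem : J.mkQ (a + c) ∈ C ^ (k + 1) • (⊤ : Submodule R (R ⧸ J)) := by
    have h : J.mkQ (a + c) = c • J.mkQ 1 := by
      rw [map_add, ← map_smul, smul_eq_mul, mul_one]
      simpa using Ideal.Quotient.eq_zero_iff_mem.2 ha
    rw [h]
    exact Submodule.smul_mem_smul hc trivial
  have hCN : C • Submodule.map J.mkQ Q ≤ ⊥ := by
    rw [← Submodule.map_smul'', Submodule.map_le_iff_le_comap, Submodule.comap_bot,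
      Submodule.ker_mkQ, Submodule.smul_le]
    exact fun r hr q hq => hIJ (Submodule.mem_colon.1 hr q hq)
  have hinf : J.mkQ (a + c) ∈
      C ^ (k + 1) • (⊤ : Submodule R (R ⧸ J)) ⊓ Submodule.map J.mkQ Q :=
    ⟨hmem, Submodule.mem_map_of_mem hxQ⟩
  rw [hk (k + 1) k.le_succ, Nat.add_sub_cancel_left, pow_one] at hinf
  have hbot := hCN (Submodule.smul_mono le_rfl inf_le_right hinf)
  rwa [← Submodule.mem_comap, Submodule.comap_bot, Submodule.ker_mkQ] at hbot

theorem permIdeal_colon_le {K : Type*} [Field K] {n : ℕ} {σ : Equiv.Perm (Fin n)}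
    {I Q : Ideal (MvPolynomial (Fin n) K)} (hI : permIdeal σ I ≤ I)
    (hQ : permIdeal σ⁻¹ Q ≤ Q) : permIdeal σ (I.colon Q) ≤ I.colon Q := by
  refine Ideal.map_le_iff_le_comap.2 fun c hc => Submodule.mem_colon.2 fun q hq => ?_
  have hq' : rename (σ⁻¹ : Equiv.Perm (Fin n)) q ∈ Q := hQ (Ideal.mem_map_of_mem _ hq)
  have h := hI (Ideal.mem_map_of_mem _ (Submodule.mem_colon.1 hc _ hq'))
  have hσ : rename σ (rename (σ⁻¹ : Equiv.Perm (Fin n)) q) = q := by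
    rw [rename_rename, ← Equiv.Perm.coe_mul, mul_inv_cancel, Equiv.Perm.coe_one, rename_id_apply]
  simpa [hσ] using h

theorem permIdeal_eq_of_forall_le {K : Type*} [Field K] {n : ℕ}
    {G : Subgroup (Equiv.Perm (Fin n))} {F : Ideal (MvPolynomial (Fin n) K)}
    (hF : ∀ σ ∈ G, permIdeal σ F ≤ F) {σ : Equiv.Perm (Fin n)} (hσ : σ ∈ G) :
    permIdeal σ F = F := by
  refine (hF σ hσ).antisymm fun x hx => ?_
  have h := Ideal.mem_map_of_mem (rename σ : _ →ₐ[K] MvPolynomial (Fin n) K)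
    (hF σ⁻¹ (inv_mem hσ) (Ideal.mem_map_of_mem _ hx))
  have hx' : rename σ (rename (σ⁻¹ : Equiv.Perm (Fin n)) x) = x := by
    rw [rename_rename, ← Equiv.Perm.coe_mul, mul_inv_cancel, Equiv.Perm.coe_one, rename_id_apply]
  exact hx' ▸ h

/-- For `G`-invariant ideals `I ⊆ Q` and a `G`-invariant separating ideal `J` for
`(I, Q)`, there exist `f_1,…,f_l` such that `I = Q ∩ (I + J + ⟨f_1,…,f_l⟩)`,
`⟨f_1,…,f_l⟩` is `G`-invariant, and `J + ⟨f_1,…,f_l⟩` is a saturated separating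
ideal for `(I, Q)`, i.e. `√(I : Q) = √(I + J + ⟨f_1,…,f_l⟩)`. -/
theorem exists_invariant_saturated_separating_ideal {K : Type*} [Field K] {n : ℕ}
    (G : Subgroup (Equiv.Perm (Fin n)))
    (I Q J : Ideal (MvPolynomial (Fin n) K))
    (hIinv : ∀ σ ∈ G, permIdeal σ I = I)
    (hQinv : ∀ σ ∈ G, permIdeal σ Q = Q)
    (hJinv : ∀ σ ∈ G, permIdeal σ J = J)
    (hIQ : I ≤ Q) (hsep : I = Q ⊓ (I + J)) :
    ∃ (l : ℕ) (f : Fin l → MvPolynomial (Fin n) K),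
      I = Q ⊓ (I + J + Ideal.span (Set.range f)) ∧
      (∀ σ ∈ G, permIdeal σ (Ideal.span (Set.range f)) = Ideal.span (Set.range f)) ∧
      (I.colon Q).radical = (I + J + Ideal.span (Set.range f)).radical := by
  obtain ⟨k, hk⟩ := Ideal.exists_inf_sup_colon_pow_le Q (le_sup_left : I ≤ I ⊔ J)
  have hJC : I ⊔ J ≤ I.colon Q := fun x hx => Submodule.mem_colon.2 fun q hq => by
    rw [hsep]
    exact ⟨Q.mul_mem_left x hq, Ideal.mul_mem_right q _ hx⟩
  obtain ⟨l, f, hf⟩ := Submodule.fg_iff_exists_fin_generating_family.1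
    (IsNoetherian.noetherian (I.colon (Q : Set (MvPolynomial (Fin n) K)) ^ (k + 1)))
  replace hf : Ideal.span (Set.range f) = I.colon Q ^ (k + 1) := hf
  refine ⟨l, f, ?_, ?_, ?_⟩ <;> rw [hf]
  · refine le_antisymm (le_inf hIQ (le_sup_left.trans le_sup_left)) ?_
    conv_rhs => rw [hsep]
    exact le_inf inf_le_left hk
  · refine fun σ hσ => permIdeal_eq_of_forall_le (fun τ hτ => ?_) hσ
    rw [permIdeal, Ideal.map_pow]
    exact Ideal.pow_right_mono
      (permIdeal_colon_le (hIinv τ hτ).le (hQinv τ⁻¹ (inv_mem hτ)).le) _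
  · refine le_antisymm ?_ (Ideal.radical_mono (sup_le hJC (Ideal.pow_le_self k.succ_ne_zero)))
    rw [← Ideal.radical_pow (I.colon (Q : Set (MvPolynomial (Fin n) K))) k.succ_ne_zero]
    exact Ideal.radical_mono le_sup_right
end
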